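/- arXiv:1911.00992 — 2 statements merged into one kernel-verified Lean document; each statement's English description precedes it below -/
import Mathlib

section
/- The one-dimensional Matérn (exponential) kernel K(x,y) = exp(−|x−y|) on ℝ is admissible: for every N, every tuple of pairwise distinct reals y¹, …, y^N, and every nonzero c ∈ ℝ^N, Σ_{n,m=1}^N c_n c_m exp(−|yⁿ − yᵐ|) > 0; i.e. the matrix (exp(−|yⁿ−yᵐ|))_{n,m} is symmetric positive definite. -/
open scoped BigOperators

/-- The quadratic form of the exponential kernel at distinct points, all smaller than `b`,
strictly exceeds the square of the exponential sum based at `b`. -/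
theorem sq_sum_mul_exp_lt_sum_sum_mul_exp_neg_abs {ι : Type*} {y : ι → ℝ}
    (hy : Function.Injective y) (c : ι → ℝ) (s : Finset ι) (hc : ∃ i ∈ s, c i ≠ 0)
    (b : ℝ) (hb : ∀ i ∈ s, y i < b) :
    (∑ i ∈ s, c i * Real.exp (y i - b)) ^ 2 <
      ∑ i ∈ s, ∑ j ∈ s, c i * c j * Real.exp (-|y i - y j|) := by
  classical
  induction s using Finset.induction_on_max_value y generalizing b with
  | empty => simp at hc
  | insert a s ha hmax ih =>
    have hlt : ∀ i ∈ s, y i < y a := fun i hi =>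
      lt_of_le_of_ne (hmax i hi) fun h => ha (hy h ▸ hi)
    have hab : y a < b := hb a (Finset.mem_insert_self a s)
    set T := ∑ i ∈ s, c i * Real.exp (y i - y a) with hT
    have hrow : ∑ j ∈ s, c a * c j * Real.exp (-|y a - y j|) = c a * T := by
      rw [hT, Finset.mul_sum]
      refine Finset.sum_congr rfl fun j hj => ?_
      rw [abs_of_pos (sub_pos.2 (hlt j hj)), neg_sub, mul_assoc]
    have hcol : ∑ i ∈ s, c i * c a * Real.exp (-|y i - y a|) = c a * T := by
      rw [← hrow]
      refine Finset.sum_congr rfl fun i _ => ?_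
      rw [abs_sub_comm, mul_comm (c i)]
    have hshift : ∑ i ∈ insert a s, c i * Real.exp (y i - b) =
        Real.exp (y a - b) * (c a + T) := by
      rw [Finset.sum_insert ha, hT, mul_add, Finset.mul_sum, mul_comm]
      congr 1
      refine Finset.sum_congr rfl fun i _ => ?_
      rw [mul_left_comm, ← Real.exp_add]
      ring_nf
    have hform : ∑ i ∈ insert a s, ∑ j ∈ insert a s, c i * c j * Real.exp (-|y i - y j|) =
        (c a + T) ^ 2 + (∑ i ∈ s, ∑ j ∈ s, c i * c j * Real.exp (-|y i - y j|) - T ^ 2) := by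
      simp only [Finset.sum_insert ha, Finset.sum_add_distrib, hrow, hcol, sub_self, abs_zero,
        neg_zero, Real.exp_zero]
      ring
    have hexp : Real.exp (y a - b) ^ 2 < 1 :=
      pow_lt_one₀ (Real.exp_pos _).le (Real.exp_lt_one_iff.2 (sub_neg.2 hab)) two_ne_zero
    rw [hshift, hform, mul_pow]
    by_cases hs : ∃ i ∈ s, c i ≠ 0
    · have := ih hs (y a) hlt
      nlinarith [mul_nonneg (sub_nonneg.2 hexp.le) (sq_nonneg (c a + T))]
    · push Not at hs
      have hca : c a ≠ 0 := by
        obtain ⟨i, hi, hi0⟩ := hc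
        rcases Finset.mem_insert.1 hi with rfl | hi
        · exact hi0
        · exact absurd (hs i hi) hi0
      have hT0 : T = 0 := Finset.sum_eq_zero fun i hi => by rw [hs i hi, zero_mul]
      have hQ0 : ∑ i ∈ s, ∑ j ∈ s, c i * c j * Real.exp (-|y i - y j|) = 0 :=
        Finset.sum_eq_zero fun i hi => Finset.sum_eq_zero fun j _ => by simp [hs i hi]
      rw [hT0, hQ0]
      simpa using mul_lt_mul_of_pos_right hexp (sq_pos_of_ne_zero hca)

theorem sum_sum_mul_exp_neg_abs_pos {ι : Type*} [Fintype ι] {y : ι → ℝ}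
    (hy : Function.Injective y) {c : ι → ℝ} (hc : c ≠ 0) :
    0 < ∑ i, ∑ j, c i * c j * Real.exp (-|y i - y j|) := by
  obtain ⟨i, hi⟩ := Function.ne_iff.1 hc
  obtain ⟨b, hb⟩ := (Set.finite_range y).bddAbove
  exact (sq_nonneg _).trans_lt <|
    sq_sum_mul_exp_lt_sum_sum_mul_exp_neg_abs hy c Finset.univ ⟨i, Finset.mem_univ i, hi⟩ (b + 1)
      fun j _ => (hb (Set.mem_range_self j)).trans_lt (lt_add_one b)

/-- the one-dimensional Matérn (exponential) kernel exp(−|x−y|) is admissible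
(strictly positive definite). -/
theorem tmm_matern_kernel_admissible_oneDim
    (N : ℕ) (y : Fin N → ℝ) (hy : Function.Injective y)
    (c : Fin N → ℝ) (hc : c ≠ 0) :
    0 < ∑ n, ∑ m, c n * c m * Real.exp (-|y n - y m|) ∧
      (Matrix.of fun n m : Fin N => Real.exp (-|y n - y m|)).PosDef := by
  refine ⟨sum_sum_mul_exp_neg_abs_pos hy hc, Matrix.PosDef.of_dotProduct_mulVec_pos ?_ ?_⟩
  · ext n m
    simp [Matrix.conjTranspose_apply, abs_sub_comm]
  · intro x hx
    refine (sum_sum_mul_exp_neg_abs_pos hy hx).trans_eq ?_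
    simp only [dotProduct, Matrix.mulVec, Matrix.of_apply, star_trivial, Finset.mul_sum]
    refine Finset.sum_congr rfl fun n _ => Finset.sum_congr rfl fun m _ => ?_
    ring
end

section
/- The tensorized Matérn kernel K(x,y) = exp(−‖x−y‖₁) on ℝ^D, where ‖z‖₁ = Σ_{d=1}^D |z_d|, is admissible: for every N, every tuple of pairwise distinct points y¹, …, y^N ∈ ℝ^D, and every nonzero c ∈ ℝ^N, Σ_{n,m=1}^N c_n c_m exp(−‖yⁿ − yᵐ‖₁) > 0; i.e. the Gram matrix (exp(−‖yⁿ−yᵐ‖₁))_{n,m} is symmetric positive definite. -/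
open scoped BigOperators

/-- Strict positive definiteness of the kernel `g (min s t) - b` on a finite set of reals, for `g`
strictly increasing and `b` a lower bound. -/
theorem sum_mul_mul_comp_min_sub_pos {g : ℝ → ℝ} (hg : StrictMono g) (c : ℝ → ℝ) (S : Finset ℝ)
    (b : ℝ) (hb : ∀ s ∈ S, b < g s) (hc : ∃ s ∈ S, c s ≠ 0) :
    0 < ∑ s ∈ S, ∑ t ∈ S, c s * c t * (g (min s t) - b) := by
  induction S using Finset.induction_on_min generalizing b with
  | empty => simp at hc
  | insert a S ha ih =>
    have haS : a ∉ S := fun h => lt_irrefl _ (ha a h)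
    have hdecomp : ∑ s ∈ insert a S, ∑ t ∈ insert a S, c s * c t * (g (min s t) - b) =
        (g a - b) * (∑ s ∈ insert a S, c s) ^ 2 +
          ∑ s ∈ S, ∑ t ∈ S, c s * c t * (g (min s t) - g a) := by
      have hsub : ∑ s ∈ S, ∑ t ∈ S, c s * c t * (g (min s t) - g a) =
          ∑ s ∈ insert a S, ∑ t ∈ insert a S, c s * c t * (g (min s t) - g a) := by
        rw [Finset.sum_insert haS, Finset.sum_eq_zero (s := insert a S), zero_add]
        · refine Finset.sum_congr rfl fun s hs => ?_
          rw [Finset.sum_insert haS, min_eq_right (ha s hs).le, sub_self, mul_zero, zero_add]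
        · intro t ht
          have hat : a ≤ t := by
            rcases Finset.mem_insert.1 ht with rfl | ht
            exacts [le_rfl, (ha t ht).le]
          rw [min_eq_left hat, sub_self, mul_zero]
      rw [hsub, sq, Finset.sum_mul_sum, Finset.mul_sum, ← Finset.sum_add_distrib]
      refine Finset.sum_congr rfl fun s _ => ?_
      rw [Finset.mul_sum, ← Finset.sum_add_distrib]
      exact Finset.sum_congr rfl fun t _ => by ring
    have hab : 0 < g a - b := sub_pos.2 (hb a (Finset.mem_insert_self a S))
    rw [hdecomp]
    by_cases hS : ∃ s ∈ S, c s ≠ 0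
    · have := ih (g a) (fun s hs => hg (ha s hs)) hS
      positivity
    · push Not at hS
      have hca : c a ≠ 0 := by
        obtain ⟨s, hs, hcs⟩ := hc
        rcases Finset.mem_insert.1 hs with rfl | hs
        exacts [hcs, absurd (hS s hs) hcs]
      have h0 : ∑ s ∈ S, ∑ t ∈ S, c s * c t * (g (min s t) - g a) = 0 :=
        Finset.sum_eq_zero fun s hs => Finset.sum_eq_zero fun t _ => by simp [hS s hs]
      rw [h0, Finset.sum_insert haS, Finset.sum_eq_zero hS, add_zero, add_zero]
      positivity

theorem exp_neg_abs_sub (s t : ℝ) :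
    Real.exp (-|s - t|) = Real.exp (-s) * Real.exp (-t) * Real.exp (2 * min s t) := by
  rw [← Real.exp_add, ← Real.exp_add, Real.exp_eq_exp]
  rcases le_total s t with h | h
  · rw [min_eq_left h, abs_of_nonpos (sub_nonpos.2 h)]
    ring
  · rw [min_eq_right h, abs_of_nonneg (sub_nonneg.2 h)]
    ring

/-- The one-dimensional exponential kernel is strictly positive definite. -/
theorem posDef_exp_neg_abs_sub (S : Finset ℝ) :
    (Matrix.of fun s t : S => Real.exp (-|(s : ℝ) - t|)).PosDef := by
  refine Matrix.PosDef.of_dotProduct_mulVec_pos ?_ fun x hx => ?_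
  · ext s t
    simp [abs_sub_comm]
  · let c : ℝ → ℝ := fun r => if h : r ∈ S then x ⟨r, h⟩ * Real.exp (-r) else 0
    have hcS (s : S) : c s = x s * Real.exp (-s) := by simp [c]
    obtain ⟨i, hi⟩ := Function.ne_iff.1 hx
    have hpos := sum_mul_mul_comp_min_sub_pos (g := fun r => Real.exp (2 * r))
      (fun r r' h => Real.exp_lt_exp.2 (by linarith)) c S 0 (fun s _ => Real.exp_pos _)
      ⟨i, i.2, by rw [hcS]; exact mul_ne_zero hi (Real.exp_ne_zero _)⟩
    rw [← Finset.sum_coe_sort] at hpos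
    refine hpos.trans_eq ?_
    simp only [dotProduct, Matrix.mulVec, Finset.mul_sum, Matrix.of_apply, Pi.star_apply,
      star_trivial]
    refine Finset.sum_congr rfl fun s _ => ?_
    rw [← Finset.sum_coe_sort]
    refine Finset.sum_congr rfl fun t _ => ?_
    rw [hcS, hcS, exp_neg_abs_sub]
    ring

/-- The tensorized exponential kernel is strictly positive definite: the Gram matrix is a principal
submatrix of a Kronecker product of lower-dimensional Gram matrices. -/
theorem posDef_exp_neg_sum_abs_sub (D : ℕ) (S : Finset (Fin D → ℝ)) :
    (Matrix.of fun p q : S => Real.exp (-∑ d, |(p : Fin D → ℝ) d - (q : Fin D → ℝ) d|)).PosDef := by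
  induction D with
  | zero =>
    have h1 : (Matrix.of fun p q : S =>
        Real.exp (-∑ d, |(p : Fin 0 → ℝ) d - (q : Fin 0 → ℝ) d|)) = 1 := by
      ext p q
      obtain rfl : p = q := Subsingleton.elim p q
      simp [Matrix.one_apply_eq]
    rw [h1]
    exact Matrix.PosDef.one
  | succ D ih =>
    let e : S → S.image (fun p => p 0) × S.image Fin.tail := fun p =>
      (⟨p.1 0, Finset.mem_image_of_mem _ p.2⟩, ⟨Fin.tail p.1, Finset.mem_image_of_mem _ p.2⟩)
    have he : Function.Injective e := fun p q h => by
      simp only [e, Prod.mk.injEq, Subtype.mk.injEq] at h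
      rw [Subtype.ext_iff, ← Fin.cons_self_tail p.1, ← Fin.cons_self_tail q.1, h.1, h.2]
    have hK := ((posDef_exp_neg_abs_sub (S.image fun p => p 0)).kronecker
      (ih (S.image Fin.tail))).submatrix he
    refine cast (congrArg Matrix.PosDef (Matrix.ext fun p q => ?_)) hK
    simp only [Matrix.of_apply, Matrix.submatrix_apply, Matrix.kroneckerMap_apply, e, Fin.tail]
    rw [← Real.exp_add, Fin.sum_univ_succ (fun d => |p.1 d - q.1 d|), neg_add]

/-- the tensorized Matérn (exponential) kernel exp(−‖x−y‖₁) on ℝ^D is admissible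
(strictly positive definite). -/
theorem tmm_tensorized_matern_kernel_admissible
    (D N : ℕ) (y : Fin N → (Fin D → ℝ)) (hy : Function.Injective y)
    (c : Fin N → ℝ) (hc : c ≠ 0) :
    0 < ∑ n, ∑ m, c n * c m * Real.exp (-(∑ d, |y n d - y m d|)) ∧
      (Matrix.of fun n m : Fin N => Real.exp (-(∑ d, |y n d - y m d|))).PosDef := by
  have hP : (Matrix.of fun n m : Fin N => Real.exp (-(∑ d, |y n d - y m d|))).PosDef := by
    let S := Finset.univ.image y
    let e : Fin N → S := fun n => ⟨y n, Finset.mem_image_of_mem _ (Finset.mem_univ n)⟩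
    have he : Function.Injective e := fun n m h => hy (Subtype.ext_iff.1 h)
    have hK := (posDef_exp_neg_sum_abs_sub D S).submatrix he
    refine cast (congrArg Matrix.PosDef (Matrix.ext fun n m => ?_)) hK
    simp only [Matrix.of_apply, Matrix.submatrix_apply, e]
  refine ⟨(hP.dotProduct_mulVec_pos hc).trans_eq ?_, hP⟩
  simp only [dotProduct, Matrix.mulVec, Finset.mul_sum, Matrix.of_apply, Pi.star_apply,
    star_trivial]
  exact Finset.sum_congr rfl fun n _ => Finset.sum_congr rfl fun m _ => by ring
end
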